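/- Mod-4-forcing Theorem: Fix a rotor sequence NEXT and an arbitrary assignment of initial rotor directions arr(x,0) ∈ DIR for all x ∈ V. For every function π : V × ℕ₀ → {0,1,2,3} satisfying π(x,t) = 0 whenever it is not the case that x₁ ≡ x₂ ≡ t (mod 2), there exists an even initial chip configuration f(·,0) : V → ℕ such that the Propp machine started from this configuration satisfies f(x,t) ≡ π(x,t) (mod 4) for all x ∈ V and all t ∈ ℕ₀. -/

import Mathlib

open Finset

/-- Vertices: we work on `ℤ × ℤ`; the grid `V` consists of points with
`x₁ ≡ x₂ (mod 2)`. -/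
abbrev Vtx : Type := ℤ × ℤ

/-- The four diagonal directions. -/
def DIRset : Finset Vtx := {(1,1), (1,-1), (-1,-1), (-1,1)}

/-- Membership in `V`: both coordinates have the same parity. -/
def inV (x : Vtx) : Prop := x.1 % 2 = x.2 % 2

/-- `H x t`: probability that a random-walk chip starting at `x` is at the
origin after `t` steps. -/
noncomputable def H (x : Vtx) (t : ℕ) : ℝ :=
  if x.1 % 2 = (t : ℤ) % 2 ∧ x.2 % 2 = (t : ℤ) % 2 ∧ |x.1| ≤ (t : ℤ) ∧ |x.2| ≤ (t : ℤ) then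
    (4 : ℝ) ^ (-(t : ℤ)) * (Nat.choose t (((t : ℤ) + x.1) / 2).toNat)
      * (Nat.choose t (((t : ℤ) + x.2) / 2).toNat)
  else 0

/-- `INF x A t := H (x+A) (t-1) - H x t`, for `t ≥ 1`. -/
noncomputable def INF (x A : Vtx) (t : ℕ) : ℝ := H (x + A) (t - 1) - H x t

/-- A rotor sequence: a cyclic permutation of the four directions. -/
def IsRotorSequence (next : Vtx → Vtx) : Prop :=
  ∀ A ∈ DIRset, ({A, next A, next^[2] A, next^[3] A} : Finset Vtx) = DIRset

/-- One step of the Propp machine: a vertex holding `k` chips and rotor `d`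
sends chip `i` (for `i = 0, …, k-1`) to `x + next^[i] d` and sets its rotor
to `next^[k] d`. -/
def proppStep (next : Vtx → Vtx) (st : (Vtx → ℕ) × (Vtx → Vtx)) :
    (Vtx → ℕ) × (Vtx → Vtx) :=
  (fun y => ∑ A ∈ DIRset,
      ((Finset.range (st.1 (y - A))).filter (fun i => next^[i] (st.2 (y - A)) = A)).card,
   fun x => next^[st.1 x] (st.2 x))

/-- The Propp machine after `t` steps: chip counts and rotor directions. -/
def propp (next : Vtx → Vtx) (f0 : Vtx → ℕ) (arr0 : Vtx → Vtx) :
    ℕ → (Vtx → ℕ) × (Vtx → Vtx)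
  | 0 => (f0, arr0)
  | t + 1 => proppStep next (propp next f0 arr0 t)

/-- An initial configuration is even if chips lie only on vertices `x ~ 0`. -/
def EvenConfig (f0 : Vtx → ℕ) : Prop :=
  ∀ x : Vtx, ¬(x.1 % 2 = 0 ∧ x.2 % 2 = 0) → f0 x = 0


def PP {M : Type} [AddCommMonoid M] (g : Vtx → M) : Vtx → M :=
  fun y => ∑ A ∈ DIRset, g (y - A)

lemma PP_apply {M : Type} [AddCommMonoid M] (g : Vtx → M) (x y : ℤ) :
    PP g (x, y) = g (x - 1, y - 1) + (g (x - 1, y + 1) + (g (x + 1, y + 1) + g (x + 1, y - 1))) := by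
  unfold PP DIRset
  rw [Finset.sum_insert (by decide), Finset.sum_insert (by decide), Finset.sum_insert (by decide),
    Finset.sum_singleton]
  simp

section rot
variable {next : Vtx → Vtx} (hnext : IsRotorSequence next)
include hnext

lemma next_mem {A : Vtx} (hA : A ∈ DIRset) : next A ∈ DIRset := by
  rw [← hnext A hA]; simp

lemma iter_mem {A : Vtx} (hA : A ∈ DIRset) (n : ℕ) : next^[n] A ∈ DIRset := by
  induction n with
  | zero => exact hA
  | succ n ih => rw [Function.iterate_succ_apply']; exact next_mem hnext ih

lemma next_distinct {A : Vtx} (hA : A ∈ DIRset) :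
    A ≠ next A ∧ A ≠ next^[2] A ∧ A ≠ next^[3] A ∧ next A ≠ next^[2] A ∧ next A ≠ next^[3] A ∧
    next^[2] A ≠ next^[3] A := by
  have h := congrArg Finset.card (hnext A hA)
  have h4 : DIRset.card = 4 := by decide
  rw [h4] at h
  generalize next A = b at *
  generalize next^[2] A = c at *
  generalize next^[3] A = d at *
  have k3 : ∀ a b c : Vtx, ({a, b, c} : Finset Vtx).card ≤ 3 := fun a b c => Finset.card_le_three
  have := k3 A b c
  have := k3 A b d
  have := k3 A c d
  have := k3 b c d
  refine ⟨?_, ?_, ?_, ?_, ?_, ?_⟩ <;> rintro rfl <;> simp at h <;> omega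

lemma next_four {A : Vtx} (hA : A ∈ DIRset) : next^[4] A = A := by
  have h1 := hnext _ (next_mem hnext hA)
  have h2 := next_distinct hnext hA
  have h3 : A ∈ ({next A, next^[1+1] A, next^[2+1] A, next^[3+1] A} : Finset Vtx) := by
    have := hA
    rw [← h1] at this
    simpa only [Function.iterate_succ_apply, Function.iterate_zero_apply] using this
  simp only [Finset.mem_insert, Finset.mem_singleton] at h3
  obtain ⟨a, b, c, _⟩ := h2
  rcases h3 with h | h | h | h
  · exact absurd h a
  · exact absurd h b
  · exact absurd h c
  · exact h.symm

lemma cnt_four {d A : Vtx} (hd : d ∈ DIRset) (hA : A ∈ DIRset) (k : ℕ) :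
    ((Finset.range (k + 4)).filter (fun i => next^[i] d = A)).card =
    ((Finset.range k).filter (fun i => next^[i] d = A)).card + 1 := by
  simp only [Finset.card_filter]
  rw [Finset.sum_range_add]
  congr 1
  have hd' := iter_mem hnext hd k
  have e : ∀ i, next^[k + i] d = next^[i] (next^[k] d) := by
    intro i; rw [add_comm, Function.iterate_add_apply]
  simp only [e]
  generalize next^[k] d = D at *
  have h1 := hnext D hd'
  have h2 := next_distinct hnext hd'
  rw [← h1] at hA
  simp only [Finset.mem_insert, Finset.mem_singleton] at hA
  simp only [Finset.sum_range_succ, Finset.sum_range_zero, Function.iterate_zero_apply,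
    Function.iterate_one]
  obtain ⟨a, b, c, d, e, f⟩ := h2
  generalize next^[2] D = D2 at *
  generalize next^[3] D = D3 at *
  rcases hA with rfl | rfl | rfl | rfl
  · simp [a.symm, b.symm, c.symm]
  · simp [a, d.symm, e.symm]
  · simp [b, d, f.symm]
  · simp [c, e, f]

lemma cnt_mul {d A : Vtx} (hd : d ∈ DIRset) (hA : A ∈ DIRset) (k m : ℕ) :
    ((Finset.range (k + 4 * m)).filter (fun i => next^[i] d = A)).card =
    ((Finset.range k).filter (fun i => next^[i] d = A)).card + m := by
  induction m with
  | zero => simp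
  | succ m ih =>
    rw [show k + 4 * (m + 1) = k + 4 * m + 4 by ring, cnt_four hnext hd hA, ih]; ring

lemma iter_mul {d : Vtx} (hd : d ∈ DIRset) (k m : ℕ) : next^[k + 4 * m] d = next^[k] d := by
  induction m with
  | zero => simp
  | succ m ih =>
    rw [show k + 4 * (m + 1) = (k + 4 * m) + 4 by ring, Function.iterate_add_apply,
      next_four hnext hd, ih]

lemma arr_mem {arr0 : Vtx → Vtx} (harr : ∀ x : Vtx, arr0 x ∈ DIRset) (f : Vtx → ℕ) (t : ℕ)
    (x : Vtx) : (propp next f arr0 t).2 x ∈ DIRset := by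
  induction t with
  | zero => exact harr x
  | succ t ih => exact iter_mem hnext ih _

lemma propp_add {arr0 : Vtx → Vtx} (harr : ∀ x : Vtx, arr0 x ∈ DIRset) (f g : Vtx → ℕ) (s : ℕ) :
    ∀ r : ℕ, propp next (fun x => f x + 4 ^ (s + r) * g x) arr0 s =
      (fun x => (propp next f arr0 s).1 x + 4 ^ r * (PP^[s] g) x, (propp next f arr0 s).2) := by
  induction s with
  | zero => intro r; simp [propp]
  | succ s ih =>
    intro r
    have := ih (r + 1)
    rw [show s + (r + 1) = s + 1 + r by ring] at this
    rw [propp, this, propp]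
    unfold proppStep
    have hm := arr_mem hnext harr f s
    refine Prod.ext (funext fun y => ?_) (funext fun y => ?_)
    · simp only [Function.iterate_succ_apply']
      rw [PP, Finset.mul_sum, ← Finset.sum_add_distrib]
      refine Finset.sum_congr rfl fun A hA => ?_
      rw [show 4 ^ (r + 1) * (PP^[s] g) (y - A) = 4 * (4 ^ r * (PP^[s] g) (y - A)) by ring,
        cnt_mul hnext (hm _) hA]
    · simp only
      rw [show 4 ^ (r + 1) * (PP^[s] g) y = 4 * (4 ^ r * (PP^[s] g) y) by ring,
        iter_mul hnext (hm _)]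
end rot

lemma dir_cases {A : Vtx} (hA : A ∈ DIRset) : (A.1 = 1 ∨ A.1 = -1) ∧ (A.2 = 1 ∨ A.2 = -1) := by
  simp only [DIRset, Finset.mem_insert, Finset.mem_singleton] at hA
  rcases hA with rfl | rfl | rfl | rfl <;> simp

lemma propp_even (next : Vtx → Vtx) (f : Vtx → ℕ) (arr0 : Vtx → Vtx) (hf : EvenConfig f) (t : ℕ) :
    ∀ x : Vtx, ¬(x.1 % 2 = (t : ℤ) % 2 ∧ x.2 % 2 = (t : ℤ) % 2) →
      (propp next f arr0 t).1 x = 0 := by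
  induction t with
  | zero => intro x hx; exact hf x (by simpa using hx)
  | succ t ih =>
    intro x hx
    simp only [propp, proppStep]
    refine Finset.sum_eq_zero fun A hA => ?_
    rw [ih (x - A)]
    · simp
    · have := dir_cases hA
      simp only [Prod.fst_sub, Prod.snd_sub]
      push_cast at hx
      omega

lemma PP_congr {M : Type} [AddCommMonoid M] (g g' : Vtx → M)
    (h : ∀ x : Vtx, x.1 % 2 = 0 ∧ x.2 % 2 = 0 → g x = g' x) (t : ℕ) :
    ∀ x : Vtx, (x.1 % 2 = (t : ℤ) % 2 ∧ x.2 % 2 = (t : ℤ) % 2) → (PP^[t] g) x = (PP^[t] g') x := by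
  induction t with
  | zero => intro x hx; exact h x (by simpa using hx)
  | succ t ih =>
    intro x hx
    simp only [Function.iterate_succ_apply']
    refine Finset.sum_congr rfl fun A hA => ih _ ?_
    have := dir_cases hA
    simp only [Prod.fst_sub, Prod.snd_sub]
    push_cast at hx
    omega

lemma PP_cast (g : Vtx → ℕ) (t : ℕ) (x : Vtx) :
    (((PP^[t] g) x : ℕ) : ZMod 4) = (PP^[t] (fun y => (g y : ZMod 4))) x := by
  induction t generalizing x with
  | zero => rfl
  | succ t ih =>
    simp only [Function.iterate_succ_apply']
    simp only [PP, Nat.cast_sum, ih]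

def seqr (c : ZMod 4) (b : ℕ → ZMod 4) : ℕ → ZMod 4
  | 0 => 0
  | 1 => c
  | n + 2 => b (n + 1) - seqr c b n

lemma exists_R (b : ℤ → ZMod 4) :
    ∃ a : ℤ → ZMod 4, a 0 = 0 ∧ a 1 = 0 ∧ ∀ k, a (k + 1) + a (k - 1) = b k := by
  refine ⟨fun k => if 0 ≤ k then seqr 0 (fun n => b n) k.toNat
    else seqr (b 0) (fun n => b (-n)) (-k).toNat, by simp [seqr], by simp [seqr], ?_⟩
  intro k
  obtain ⟨n, rfl | rfl⟩ := Int.eq_nat_or_neg k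
  · rcases n with _ | n
    · simp [seqr]
    · have e1 : (((n + 1 : ℕ) : ℤ) + 1).toNat = n + 2 := by omega
      have e2 : (((n + 1 : ℕ) : ℤ) - 1).toNat = n := by omega
      simp only [e1, e2]
      rw [if_pos (by omega), if_pos (by omega), seqr]; ring
  · rcases n with _ | n
    · simp [seqr]
    · have e1 : (-(-((n + 1 : ℕ) : ℤ) - 1)).toNat = n + 2 := by omega
      have e2 : (-(-((n + 1 : ℕ) : ℤ) + 1)).toNat = n := by omega
      simp only [e1, e2]
      rw [if_neg (by omega : ¬ (0 ≤ -((n + 1 : ℕ) : ℤ) - 1)), seqr]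
      rcases n with _ | n
      · simp [seqr]
      · rw [if_neg (by omega)]; ring

lemma R_vanish (a b : ℤ → ZMod 4) (h0 : a 0 = 0) (h1 : a 1 = 0)
    (h : ∀ k, a (k + 1) + a (k - 1) = b k) (m : ℕ) (hb : ∀ k : ℤ, k.natAbs < m → b k = 0) :
    ∀ k : ℤ, k.natAbs < m + 1 → a k = 0 := by
  have key : ∀ n : ℕ, n ≤ m → a n = 0 ∧ a (-n) = 0 := by
    intro n
    induction n using Nat.twoStepInduction with
    | zero => intro _; simp [h0]
    | one =>
      intro hm
      have := h 0
      rw [hb 0 (by simp; omega)] at this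
      simp [h1] at this
      simp [h1, this]
    | more n ih _ =>
      intro hm
      obtain ⟨i1, i2⟩ := ih (by omega)
      have u := h (n + 1)
      have v := h (-(n + 1))
      rw [hb _ (by omega), show (n : ℤ) + 1 - 1 = n by ring, i1] at u
      rw [hb _ (by omega), show -((n : ℤ) + 1) + 1 = -n by ring, i2] at v
      rw [show ((n + 2 : ℕ) : ℤ) = n + 1 + 1 by push_cast; ring,
        show -((n : ℤ) + 1 + 1) = -(n + 1) - 1 by ring]
      exact ⟨by simpa using u, by simpa using v⟩
  intro k hk
  obtain ⟨n, rfl | rfl⟩ := Int.eq_nat_or_neg k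
  · exact (key n (by omega)).1
  · exact (key n (by omega)).2

lemma exists_Q (t : ℕ) : ∀ b : Vtx → ZMod 4, ∃ g : Vtx → ZMod 4, PP^[t] g = b ∧
    ∀ y : Vtx, y.2.natAbs < t → g y = 0 := by
  induction t with
  | zero => intro b; exact ⟨b, rfl, by simp⟩
  | succ t ih =>
    intro b
    obtain ⟨g, hg, hv⟩ := ih b
    choose R R0 R1 R2 using exists_R
    let c : Vtx → ZMod 4 := fun y => R (fun k => g (y.1, k)) y.2
    let a : Vtx → ZMod 4 := fun y => R (fun k => c (k, y.2)) y.1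
    have hPa : PP a = g := by
      funext ⟨x, y⟩
      rw [PP_apply]
      have u := R2 (fun k => c (k, y - 1)) x
      have v := R2 (fun k => c (k, y + 1)) x
      have w := R2 (fun k => g (x, k)) y
      simp only [a]
      simp only [c] at u v ⊢
      rw [← w, ← u, ← v]; ring
    have hc : ∀ y : Vtx, y.2.natAbs < t + 1 → c y = 0 := by
      intro y hy
      exact R_vanish _ _ (R0 _) (R1 _) (R2 _) t (fun k hk => hv _ hk) _ hy
    refine ⟨a, by rw [Function.iterate_succ_apply, hPa, hg], fun y hy => ?_⟩
    exact R_vanish _ _ (R0 _) (R1 _) (R2 _) (y.1.natAbs) (fun k _ => hc (k, y.2) hy) y.1 (by omega)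

lemma exists_step (t : ℕ) (b : Vtx → ZMod 4) : ∃ g : Vtx → ℕ, EvenConfig g ∧
    (∀ x : Vtx, (x.1 % 2 = (t : ℤ) % 2 ∧ x.2 % 2 = (t : ℤ) % 2) →
      (((PP^[t] g) x : ℕ) : ZMod 4) = b x) ∧
    ∀ y : Vtx, y.2.natAbs < t → g y = 0 := by
  obtain ⟨g, hg, hv⟩ := exists_Q t b
  refine ⟨fun y => if y.1 % 2 = 0 ∧ y.2 % 2 = 0 then (g y).val else 0, ?_, ?_, ?_⟩
  · intro x hx; simp only [if_neg hx]
  · intro x hx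
    rw [PP_cast, ← hg]
    refine PP_congr _ _ ?_ t x hx
    intro y hy
    simp only [if_pos hy]
    exact ZMod.natCast_zmod_val _
  · intro y hy
    simp [hv y hy]

/-- **Mod-4-forcing Theorem.**  For any rotor sequence, any initial rotor
directions, and any prescription `pi` of residues mod 4 (vanishing off the
correct parity class), there is an even initial configuration whose Propp
machine realizes `pi` mod 4 at all vertices and times. -/
theorem mod4_forcing (next : Vtx → Vtx) (hnext : IsRotorSequence next)
    (arr0 : Vtx → Vtx) (harr : ∀ x : Vtx, arr0 x ∈ DIRset)
    (pi : Vtx → ℕ → ℕ) (hpi4 : ∀ (x : Vtx) (t : ℕ), pi x t < 4)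
    (hpi0 : ∀ (x : Vtx) (t : ℕ),
      ¬(x.1 % 2 = (t : ℤ) % 2 ∧ x.2 % 2 = (t : ℤ) % 2) → pi x t = 0) :
    ∃ f0 : Vtx → ℕ, EvenConfig f0 ∧
      ∀ (x : Vtx) (t : ℕ), (propp next f0 arr0 t).1 x % 4 = pi x t := by
  choose G GE GP GV using exists_step
  let F : ℕ → Vtx → ℕ := fun n => Nat.rec (fun _ => 0) (fun t f x => f x + 4 ^ t *
    G t (fun x => (pi x t : ZMod 4) - ((propp next f arr0 t).1 x : ZMod 4)) x) n
  let g : ℕ → Vtx → ℕ := fun t =>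
    G t (fun x => (pi x t : ZMod 4) - ((propp next (F t) arr0 t).1 x : ZMod 4))
  have F0 : ∀ x, F 0 x = 0 := fun x => rfl
  have FS : ∀ t, F (t + 1) = fun x => F t x + 4 ^ t * g t x := fun t => rfl
  have FE : ∀ t, EvenConfig (F t) := by
    intro t
    induction t with
    | zero => intro x _; rfl
    | succ t ih => intro x hx; rw [FS]; simp only [ih x hx, g, GE t _ x hx]; simp
  have hF : ∀ (t : ℕ) (x : Vtx), (x.1 % 2 = (t : ℤ) % 2 ∧ x.2 % 2 = (t : ℤ) % 2) →
      ((propp next (F (t + 1)) arr0 t).1 x : ZMod 4) = pi x t := by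
    intro t x hx
    have h := propp_add hnext harr (F t) (g t) t 0
    rw [add_zero] at h
    rw [FS, h]
    simp only [pow_zero, one_mul, Nat.cast_add]
    rw [GP t _ x hx]; ring
  have hstab : ∀ (y : Vtx) (n : ℕ), F (y.2.natAbs + 1 + n) y = F (y.2.natAbs + 1) y := by
    intro y n
    induction n with
    | zero => rfl
    | succ n ih =>
      rw [← add_assoc, FS]
      simp only [ih, g]
      rw [GV _ _ y (by omega)]; simp
  have hdiv : ∀ (y : Vtx) (m n : ℕ), ∃ h, F (m + n) y = F m y + 4 ^ m * h := by
    intro y m n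
    induction n with
    | zero => exact ⟨0, by simp⟩
    | succ n ih =>
      obtain ⟨h, hh⟩ := ih
      refine ⟨h + 4 ^ n * g (m + n) y, ?_⟩
      rw [← add_assoc, FS]
      simp only [hh]
      ring
  have hE : EvenConfig (fun y => F (y.2.natAbs + 1) y) := fun x hx => FE (x.2.natAbs + 1) x hx
  refine ⟨fun y => F (y.2.natAbs + 1) y, hE, ?_⟩
  intro x t
  by_cases hx : x.1 % 2 = (t : ℤ) % 2 ∧ x.2 % 2 = (t : ℤ) % 2
  · have : ∀ y : Vtx, ∃ h, F (y.2.natAbs + 1) y = F (t + 1) y + 4 ^ (t + 1) * h := by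
      intro y
      obtain ⟨h, hh⟩ := hdiv y (t + 1) (y.2.natAbs)
      refine ⟨h, ?_⟩
      rw [← hh, ← hstab y t]
      congr 1
      ring
    choose h hh using this
    have e : (fun y : Vtx => F (y.2.natAbs + 1) y) = fun y => F (t + 1) y + 4 ^ (t + 1) * h y :=
      funext hh
    rw [e, propp_add hnext harr (F (t + 1)) h t 1]
    have := hF t x hx
    rw [ZMod.natCast_eq_natCast_iff'] at this
    have := hpi4 x t
    simp only
    omega
  · rw [propp_even next _ arr0 hE t x hx, hpi0 x t hx]
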